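/- Fix δ > 0, 0 < μ₁ ≤ μ₂ and 0 < A₁ ≤ A₂. There exist ε₀ > 0 and C > 0 such that for all ε ∈ (0,ε₀), all ξ ∈ Ω with dist(ξ,∂Ω) ≥ δ, all μ ∈ [μ₁,μ₂] and all A ∈ [A₁,A₂], one has | P U_{ε,μ,ξ}(x) − 8π G(x,ξ) | ≤ C ε² for every x ∈ Ω with |x − ξ| ≥ δ/2. -/

import Mathlib

open Real Set Metric Filter MeasureTheory

/-- The Laplacian of a real-valued function on the plane ℝ² ≅ ℂ. -/
noncomputable def planeLap (f : ℂ → ℝ) (x : ℂ) : ℝ :=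
  fderiv ℝ (fun y => fderiv ℝ f y 1) x 1 +
  fderiv ℝ (fun y => fderiv ℝ f y Complex.I) x Complex.I

/-- A function is harmonic on a set if it is C² there with vanishing Laplacian. -/
def HarmonicOnSet (f : ℂ → ℝ) (s : Set ℂ) : Prop :=
  ContDiffOn ℝ 2 f s ∧ ∀ x ∈ s, planeLap f x = 0

/-- `RegPart Ω H`: H is the regular part of the Dirichlet Green's function of −Δ on Ω:
for each x ∈ Ω, y ↦ H(x,y) is harmonic on Ω, extends continuously to the closure of Ω,
with boundary values (1/(2π))·log|x−y| on ∂Ω; moreover H is symmetric on Ω × Ω. -/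
def RegPart (Ω : Set ℂ) (H : ℂ → ℂ → ℝ) : Prop :=
  (∀ x ∈ Ω, HarmonicOnSet (fun y => H x y) Ω ∧
      ContinuousOn (fun y => H x y) (closure Ω) ∧
      ∀ y ∈ frontier Ω, H x y = (1 / (2 * π)) * Real.log ‖x - y‖) ∧
  (∀ x ∈ Ω, ∀ y ∈ Ω, H x y = H y x)

/-- The Green's function G(x,y) = (1/(2π))·log(1/|x−y|) + H(x,y). -/
noncomputable def green (H : ℂ → ℂ → ℝ) (x y : ℂ) : ℝ :=
  (1 / (2 * π)) * Real.log (1 / ‖x - y‖) + H x y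

/-- The bubble U_{ε,μ,ξ}(x) = log( 8μ² / ((μ²ε² + |x−ξ|²)²·A) ). -/
noncomputable def bubbleU (ε μ A : ℝ) (ξ x : ℂ) : ℝ :=
  Real.log (8 * μ ^ 2 / ((μ ^ 2 * ε ^ 2 + ‖x - ξ‖ ^ 2) ^ 2 * A))

/-- `IsProj Ω PU ε μ A ξ`: PU is the projection of U_{ε,μ,ξ} onto zero boundary values:
PU is continuous on the closure of Ω, PU − U is harmonic in Ω, and PU = 0 on ∂Ω. -/
def IsProj (Ω : Set ℂ) (PU : ℂ → ℝ) (ε μ A : ℝ) (ξ : ℂ) : Prop :=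
  ContinuousOn PU (closure Ω) ∧
  HarmonicOnSet (fun x => PU x - bubbleU ε μ A ξ x) Ω ∧
  ∀ x ∈ frontier Ω, PU x = 0

open InnerProductSpace Topology

theorem planeLap_eq_laplacian {f : ℂ → ℝ} {x : ℂ} (hf : ContDiffAt ℝ 2 f x) :
    planeLap f x = Laplacian.laplacian f x := by
  have hd : DifferentiableAt ℝ (fderiv ℝ f) x :=
    (hf.fderiv_right (m := 1) (by norm_num)).differentiableAt (by norm_num)
  rw [laplacian_eq_iteratedFDeriv_complexPlane]
  simp [planeLap, iteratedFDeriv_two_apply, fderiv_clm_apply hd (differentiableAt_const _)]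

theorem HarmonicOnSet.harmonicOnNhd {f : ℂ → ℝ} {s : Set ℂ} (hs : IsOpen s)
    (hf : HarmonicOnSet f s) : HarmonicOnNhd f s := by
  intro x hx
  have hc : ∀ y ∈ s, ContDiffAt ℝ 2 f y := fun y hy => hf.1.contDiffAt (hs.mem_nhds hy)
  refine ⟨hc x hx, ?_⟩
  filter_upwards [hs.mem_nhds hx] with y hy
  rw [← planeLap_eq_laplacian (hc y hy), hf.2 y hy, Pi.zero_apply]

theorem HarmonicAt.eventually_eq_of_isLocalMax {f : ℂ → ℝ} {z : ℂ} (hf : HarmonicAt f z)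
    (hz : IsLocalMax f z) : ∀ᶠ w in 𝓝 z, f w = f z := by
  obtain ⟨r, hr, hball⟩ := Metric.eventually_nhds_iff_ball.1 hf.eventually
  obtain ⟨F, hF, hre⟩ := HarmonicOnNhd.exists_analyticOnNhd_ball_re_eq
    (f := f) (z := z) (R := r) (fun y hy => hball y hy)
  have hre' : ∀ w ∈ ball z r, ‖Complex.exp (F w)‖ = Real.exp (f w) := fun w hw => by
    rw [Complex.norm_exp, ← hre hw]
  have hbz : ball z r ∈ 𝓝 z := ball_mem_nhds z hr
  have hd : ∀ᶠ w in 𝓝 z, DifferentiableAt ℂ (fun w => Complex.exp (F w)) w := by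
    filter_upwards [hbz] with w hw
    exact (hF w hw).differentiableAt.cexp
  have hmax : IsLocalMax (norm ∘ fun w => Complex.exp (F w)) z := by
    filter_upwards [hbz, hz] with w hw hle
    simpa [hre' w hw, hre' z (mem_ball_self hr)] using hle
  filter_upwards [hbz, Complex.eventually_eq_of_isLocalMax_norm hd hmax] with w hw heq
  have h := congrArg norm heq
  rw [hre' w hw, hre' z (mem_ball_self hr)] at h
  exact Real.exp_injective h

/-- The maximum principle for harmonic functions on bounded planar domains. -/
theorem HarmonicOnNhd.le_of_forall_frontier_le {f : ℂ → ℝ} {s : Set ℂ} {M : ℝ}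
    (ho : IsOpen s) (hc : IsConnected s) (hb : Bornology.IsBounded s)
    (hf : HarmonicOnNhd f s) (hfc : ContinuousOn f (closure s))
    (hM : ∀ x ∈ frontier s, f x ≤ M) {x : ℂ} (hx : x ∈ s) : f x ≤ M := by
  obtain ⟨z, hz, hmax⟩ := hb.isCompact_closure.exists_isMaxOn hc.nonempty.closure hfc
  suffices h : f z ≤ M from (hmax (subset_closure hx)).trans h
  by_cases hzs : z ∈ s
  swap
  · exact hM z (ho.frontier_eq ▸ ⟨hz, hzs⟩)
  have hloc : ∀ y ∈ s, f y = f z → ∀ᶠ w in 𝓝 y, f w = f z := by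
    intro y hy hyz
    rw [← hyz]
    refine HarmonicAt.eventually_eq_of_isLocalMax (hf y hy) ?_
    filter_upwards [ho.mem_nhds hy] with w hw
    exact hyz ▸ hmax (subset_closure hw)
  have hsub : s ⊆ {y | ∀ᶠ w in 𝓝 y, f w = f z} := by
    refine hc.isPreconnected.subset_of_closure_inter_subset isOpen_setOfPred_eventually_nhds
      ⟨z, hzs, hloc z hzs rfl⟩ ?_
    rintro y ⟨hyc, hys⟩
    refine hloc y hys ?_
    have hca : ContinuousAt f y := hfc.continuousAt (mem_of_superset (ho.mem_nhds hys) subset_closure)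
    refine tendsto_nhds_unique_of_frequently_eq hca tendsto_const_nhds ?_
    exact (mem_closure_iff_frequently.1 hyc).mono fun w hw => hw.self_of_nhds
  have heq : EqOn f (fun _ => f z) (closure s) :=
    EqOn.of_subset_closure (fun y hy => (hsub hy).self_of_nhds) hfc continuousOn_const
      subset_closure subset_rfl
  obtain ⟨y, hy⟩ : (frontier s).Nonempty := by
    refine nonempty_frontier_iff.2 ⟨hc.nonempty, ?_⟩
    rintro rfl
    exact NormedSpace.unbounded_univ ℝ ℂ hb
  exact (heq (frontier_subset_closure hy)).symm.trans_le (hM y hy)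

theorem continuous_bubbleU {ε μ A : ℝ} (hε : 0 < ε) (hμ : 0 < μ) (hA : 0 < A) (ξ : ℂ) :
    Continuous (bubbleU ε μ A ξ) := by
  have hne : ∀ x : ℂ, (μ ^ 2 * ε ^ 2 + ‖x - ξ‖ ^ 2) ^ 2 * A ≠ 0 := fun x => by positivity
  unfold bubbleU
  refine Continuous.log (continuous_const.div (by fun_prop) hne) fun x => ?_
  positivity

theorem bubbleU_eq {ε μ A : ℝ} {ξ x : ℂ} (hμ : 0 < μ) (hA : 0 < A) (hx : 0 < ‖x - ξ‖) :
    bubbleU ε μ A ξ x = Real.log (8 * μ ^ 2 / A) - 4 * Real.log ‖x - ξ‖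
      - 2 * Real.log (1 + μ ^ 2 * ε ^ 2 / ‖x - ξ‖ ^ 2) := by
  have h : 8 * μ ^ 2 / ((μ ^ 2 * ε ^ 2 + ‖x - ξ‖ ^ 2) ^ 2 * A) =
      8 * μ ^ 2 / A / ‖x - ξ‖ ^ 4 / (1 + μ ^ 2 * ε ^ 2 / ‖x - ξ‖ ^ 2) ^ 2 := by
    field_simp
    ring
  rw [bubbleU, h, Real.log_div (by positivity) (by positivity),
    Real.log_div (by positivity) (by positivity), Real.log_pow, Real.log_pow]
  push_cast
  ring

theorem two_mul_log_one_add_div_mem_Icc {ε μ ρ r : ℝ} (hρ : 0 < ρ) (hr : ρ ≤ r) :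
    2 * Real.log (1 + μ ^ 2 * ε ^ 2 / r ^ 2) ∈ Set.Icc 0 (2 * (μ ^ 2 * ε ^ 2 / ρ ^ 2)) := by
  have h0 : 0 ≤ μ ^ 2 * ε ^ 2 / r ^ 2 := by positivity
  have h1 : μ ^ 2 * ε ^ 2 / r ^ 2 ≤ μ ^ 2 * ε ^ 2 / ρ ^ 2 := by gcongr
  have h2 := Real.log_le_sub_one_of_pos (show 0 < 1 + μ ^ 2 * ε ^ 2 / r ^ 2 by linarith)
  have h3 := Real.log_nonneg (show 1 ≤ 1 + μ ^ 2 * ε ^ 2 / r ^ 2 by linarith)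
  constructor <;> linarith

/-- The harmonic remainder `PU − U − 8πH(ξ,·) + log (8μ²/A)` is controlled by its boundary values
`2 log (1 + μ²ε²/|x−ξ|²)`. -/
theorem IsProj.remainder_mem_Icc {Ω : Set ℂ} (hΩo : IsOpen Ω) (hΩc : IsConnected Ω)
    (hΩb : Bornology.IsBounded Ω) {H : ℂ → ℂ → ℝ} (hH : RegPart Ω H) {PU : ℂ → ℝ}
    {ε μ A δ : ℝ} {ξ : ℂ} (hε : 0 < ε) (hμ : 0 < μ) (hA : 0 < A) (hδ : 0 < δ) (hξ : ξ ∈ Ω)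
    (hd : δ ≤ Metric.infDist ξ (frontier Ω)) (hP : IsProj Ω PU ε μ A ξ) {x : ℂ} (hx : x ∈ Ω) :
    PU x - bubbleU ε μ A ξ x - 8 * π * H ξ x + Real.log (8 * μ ^ 2 / A) ∈
      Set.Icc 0 (2 * (μ ^ 2 * ε ^ 2 / δ ^ 2)) := by
  obtain ⟨hPc, hPh, hPb⟩ := hP
  obtain ⟨hHh, hHc, hHb⟩ := hH.1 ξ hξ
  set w : ℂ → ℝ := fun y => PU y - bubbleU ε μ A ξ y - 8 * π * H ξ y + Real.log (8 * μ ^ 2 / A)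
    with hw
  have hwh : HarmonicOnNhd w Ω := by
    intro y hy
    exact ((hPh.harmonicOnNhd hΩo y hy).sub
      ((hHh.harmonicOnNhd hΩo y hy).const_smul (c := 8 * π))).add (harmonicAt_const _)
  have hwc : ContinuousOn w (closure Ω) :=
    ((hPc.sub (continuous_bubbleU hε hμ hA ξ).continuousOn).sub
      (continuousOn_const.mul hHc)).add continuousOn_const
  have hwb : ∀ y ∈ frontier Ω, w y ∈ Set.Icc 0 (2 * (μ ^ 2 * ε ^ 2 / δ ^ 2)) := by
    intro y hy
    have hr : δ ≤ ‖y - ξ‖ := by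
      rw [← dist_eq_norm, dist_comm]
      exact hd.trans (Metric.infDist_le_dist_of_mem hy)
    have hval : w y = 2 * Real.log (1 + μ ^ 2 * ε ^ 2 / ‖y - ξ‖ ^ 2) := by
      simp only [hw]
      rw [hPb y hy, hHb y hy, bubbleU_eq hμ hA (hδ.trans_le hr), norm_sub_rev ξ y]
      field_simp
      ring
    exact hval ▸ two_mul_log_one_add_div_mem_Icc hδ hr
  refine ⟨?_, HarmonicOnNhd.le_of_forall_frontier_le hΩo hΩc hΩb hwh hwc
    (fun y hy => (hwb y hy).2) hx⟩
  have h := HarmonicOnNhd.le_of_forall_frontier_le (f := -w) (M := 0) hΩo hΩc hΩb hwh.neg hwc.neg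
    (fun y hy => neg_nonpos.2 (hwb y hy).1) hx
  exact neg_nonpos.1 h

/-- |PU_{ε,μ,ξ}(x) − 8πG(x,ξ)| ≤ Cε² for |x − ξ| ≥ δ/2, uniformly for ξ at
distance ≥ δ from ∂Ω, μ ∈ [μ₁,μ₂] and A ∈ [A₁,A₂]. -/
theorem projection_expansion_away (Ω : Set ℂ) (hΩo : IsOpen Ω) (hΩc : IsConnected Ω)
    (hΩb : Bornology.IsBounded Ω) (H : ℂ → ℂ → ℝ) (hH : RegPart Ω H)
    (δ μ₁ μ₂ A₁ A₂ : ℝ) (hδ : 0 < δ) (hμ₁ : 0 < μ₁) (hμ : μ₁ ≤ μ₂) (hA₁ : 0 < A₁)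
    (hA : A₁ ≤ A₂) (PU : ℝ → ℝ → ℝ → ℂ → ℂ → ℝ)
    (hPU : ∀ ε > (0 : ℝ), ∀ μ ∈ Set.Icc μ₁ μ₂, ∀ A ∈ Set.Icc A₁ A₂, ∀ ξ ∈ Ω,
      IsProj Ω (PU ε μ A ξ) ε μ A ξ) :
    ∃ ε₀ > (0 : ℝ), ∃ C > (0 : ℝ), ∀ ε ∈ Set.Ioo 0 ε₀, ∀ ξ ∈ Ω,
      δ ≤ Metric.infDist ξ (frontier Ω) → ∀ μ ∈ Set.Icc μ₁ μ₂, ∀ A ∈ Set.Icc A₁ A₂,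
      ∀ x ∈ Ω, δ / 2 ≤ ‖x - ξ‖ →
        |PU ε μ A ξ x - 8 * π * green H x ξ| ≤ C * ε ^ 2 := by
  refine ⟨1, one_pos, 8 * μ₂ ^ 2 / δ ^ 2, by have := hμ₁.trans_le hμ; positivity, ?_⟩
  intro ε hε ξ hξ hd μ hμI A hAI x hx hxξ
  have hμ0 : 0 < μ := hμ₁.trans_le hμI.1
  have hA0 : 0 < A := hA₁.trans_le hAI.1
  have hrem := (hPU ε hε.1 μ hμI A hAI ξ hξ).remainder_mem_Icc hΩo hΩc hΩb hH hε.1 hμ0 hA0 hδ hξ hd hx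
  have hlog := two_mul_log_one_add_div_mem_Icc (ε := ε) (μ := μ) (half_pos hδ) hxξ
  have hsq : μ ^ 2 * ε ^ 2 / δ ^ 2 ≤ μ₂ ^ 2 * ε ^ 2 / δ ^ 2 := by
    gcongr
    exact hμI.2
  have hnn : 0 ≤ μ₂ ^ 2 * ε ^ 2 / δ ^ 2 := by positivity
  have hhalf : μ ^ 2 * ε ^ 2 / (δ / 2) ^ 2 = 4 * (μ ^ 2 * ε ^ 2 / δ ^ 2) := by
    field_simp
    norm_num
  have hC : 8 * μ₂ ^ 2 / δ ^ 2 * ε ^ 2 = 8 * (μ₂ ^ 2 * ε ^ 2 / δ ^ 2) := by ring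
  have hgreen : 8 * π * green H x ξ = -(4 * Real.log ‖x - ξ‖) + 8 * π * H ξ x := by
    rw [green, one_div ‖x - ξ‖, Real.log_inv, hH.2 x hx ξ hξ]
    field_simp
    ring
  rw [bubbleU_eq hμ0 hA0 ((half_pos hδ).trans_le hxξ)] at hrem
  rw [hhalf] at hlog
  rw [hgreen, hC, abs_le]
  constructor <;> linarith [hrem.1, hrem.2, hlog.1, hlog.2]
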